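/- arXiv:1502.00693 — 2 statements merged into one kernel-verified Lean document; each statement's English description precedes it below -/
import Mathlib

section
/- Fix a projective line L∞ ⊂ ℙ²(ℝ), identify ℝ² = ℙ²(ℝ)∖L∞, and fix a nondegenerate triangle XYZ in ℝ². Consider the space of hexagonal typical 6-configurations P ⊂ ℝ² with consecutive cyclic labeling p₁,…,p₆ (coming from convex position in ℝ²) such that: p₁ and p₄ lie on the line XY with X, Y, p₁, p₄ occurring in this consecutive order along the line; p₂ and p₃ lie on the line XZ; p₅ and p₆ lie on the line YZ; p₁ is dominant in P; and the open triangle XYZ is disjoint from all 15 lines through pairs of points of P. Then this space is path-connected: any two such configurations are joined by a continuous family of configurations of the same form. -/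
open scoped LinearAlgebra.Projectivization
open Projectivization

noncomputable section

/-- The real projective plane: the projectivization of `ℝ³`. -/
abbrev RP2 := ℙ ℝ (Fin 3 → ℝ)

/-- The quotient topology on the real projective plane. -/
instance : TopologicalSpace RP2 :=
  inferInstanceAs (TopologicalSpace (Quotient (projectivizationSetoid ℝ (Fin 3 → ℝ))))

/-- Three points of `ℙ²(ℝ)` are collinear if they admit linearly dependent representatives. -/
def Collin (a b c : RP2) : Prop :=
  ¬ LinearIndependent ℝ ![a.rep, b.rep, c.rep]

/-- The conic (zero set in `ℙ²(ℝ)`) associated to a quadratic form on `ℝ³`. -/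
def ConicSet (q : QuadraticForm ℝ (Fin 3 → ℝ)) : Set RP2 := {p : RP2 | q p.rep = 0}

/-- A set of points is coconic if some conic contains all of them. -/
def Coconic (s : Set RP2) : Prop :=
  ∃ q : QuadraticForm ℝ (Fin 3 → ℝ), q ≠ 0 ∧ ∀ p ∈ s, q p.rep = 0

/-- A labeled `n`-configuration is simple if it is injective and has no collinear triple. -/
def SimpleCfg {n : ℕ} (f : Fin n → RP2) : Prop :=
  Function.Injective f ∧
    ∀ i j k : Fin n, i ≠ j → i ≠ k → j ≠ k → ¬ Collin (f i) (f j) (f k)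

/-- A labeled `n`-configuration is typical if it is simple and no six of its points are coconic. -/
def TypicalCfg {n : ℕ} (f : Fin n → RP2) : Prop :=
  SimpleCfg f ∧ ∀ g : Fin 6 → Fin n, Function.Injective g → ¬ Coconic (Set.range (f ∘ g))

/-- A projective line: the set of points whose representatives lie in a 2-dimensional
subspace of `ℝ³`. -/
def IsProjLine (L : Set RP2) : Prop :=
  ∃ W : Submodule ℝ (Fin 3 → ℝ), Module.finrank ℝ W = 2 ∧ L = {p : RP2 | p.rep ∈ W}

/-- `p` lies inside the conic of `q` if every projective line through `p` meets the conic. -/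
def InsideConic (q : QuadraticForm ℝ (Fin 3 → ℝ)) (p : RP2) : Prop :=
  ∀ L : Set RP2, IsProjLine L → p ∈ L → (L ∩ ConicSet q).Nonempty

/-- `p` lies outside the conic of `q` if some projective line through `p` misses the conic. -/
def OutsideConic (q : QuadraticForm ℝ (Fin 3 → ℝ)) (p : RP2) : Prop :=
  ∃ L : Set RP2, IsProjLine L ∧ p ∈ L ∧ L ∩ ConicSet q = ∅

/-- A point `f i` of a configuration is dominant if it lies outside every conic passing
through all the other points of the configuration. -/
def Dominant {n : ℕ} (f : Fin n → RP2) (i : Fin n) : Prop :=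
  ∀ q : QuadraticForm ℝ (Fin 3 → ℝ), q ≠ 0 → (∀ j, j ≠ i → q ((f j).rep) = 0) →
    OutsideConic q (f i)

/-- A point `f i` of a configuration is subdominant if it lies inside every conic passing
through all the other points of the configuration. -/
def Subdominant {n : ℕ} (f : Fin n → RP2) (i : Fin n) : Prop :=
  ∀ q : QuadraticForm ℝ (Fin 3 → ℝ), q ≠ 0 → (∀ j, j ≠ i → q ((f j).rep) = 0) →
    InsideConic q (f i)

/-- The affine chart determined by a nonzero linear functional `φ` (with `L∞ = {φ = 0}`):
a point off `L∞` is sent to its representative rescaled to lie on the affine plane `φ = 1`. -/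
def chart (φ : (Fin 3 → ℝ) →ₗ[ℝ] ℝ) (p : RP2) : Fin 3 → ℝ := (φ p.rep)⁻¹ • p.rep

/-- Convex position with respect to the affine chart of `φ`: the line `{φ = 0}` misses the
configuration, and in the chart every point lies outside the convex hull of the others. -/
def ConvexPosWith {n : ℕ} (φ : (Fin 3 → ℝ) →ₗ[ℝ] ℝ) (f : Fin n → RP2) : Prop :=
  φ ≠ 0 ∧ (∀ i, φ (f i).rep ≠ 0) ∧
    ∀ i, chart φ (f i) ∉ convexHull ℝ (chart φ '' (f '' {j | j ≠ i}))

/-- A configuration is in convex position if it is so in some affine chart. -/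
def ConvexPos {n : ℕ} (f : Fin n → RP2) : Prop := ∃ φ, ConvexPosWith φ f

/-- The labeling of a configuration is consecutive for the convex position in the chart of `φ`:
each pair `f i`, `f (i+1)` (cyclically) spans an edge of the convex polygon, i.e. is cut out by
an affine functional which is strictly larger on both of them than on all the other points. -/
def ConsecWith {n : ℕ} [NeZero n] (φ : (Fin 3 → ℝ) →ₗ[ℝ] ℝ) (f : Fin n → RP2) : Prop :=
  ConvexPosWith φ f ∧
    ∀ i : Fin n, ∃ ψ : (Fin 3 → ℝ) →ₗ[ℝ] ℝ,
      ψ (chart φ (f i)) = ψ (chart φ (f (i + 1))) ∧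
      ∀ j : Fin n, j ≠ i → j ≠ i + 1 → ψ (chart φ (f j)) < ψ (chart φ (f i))

/-- A configuration is in convex position with consecutive cyclic labeling. -/
def ConsecConvexPos {n : ℕ} [NeZero n] (f : Fin n → RP2) : Prop := ∃ φ, ConsecWith φ f

/-- A Q-deformation (an `n`-tuple of continuous paths through typical configurations). -/
def QDeformFam (n : ℕ) (γ : Fin n → unitInterval → RP2) : Prop :=
  (∀ i, Continuous (γ i)) ∧ ∀ t : unitInterval, TypicalCfg (fun i => γ i t)

end
noncomputable section

/-- A hexagonal typical 6-configuration with consecutive labeling `p₁,…,p₆` (in the affine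
chart of `φ`) such that `p₁, p₄` lie on the line `XY` with `X, Y, p₁, p₄` in consecutive
order, `p₂, p₃` lie on the line `XZ`, `p₅, p₆` lie on the line `YZ`, the point `p₁` is
dominant, and the open triangle `XYZ` is disjoint from all 15 lines through pairs of points
of the configuration. -/
def TriSideCfg (φ : (Fin 3 → ℝ) →ₗ[ℝ] ℝ) (X Y Z : Fin 3 → ℝ) (f : Fin 6 → RP2) : Prop :=
  TypicalCfg f ∧ ConsecWith φ f ∧
  (∃ s u : ℝ, 0 < s ∧ s < u ∧
    chart φ (f 0) = Y + s • (Y - X) ∧ chart φ (f 3) = Y + u • (Y - X)) ∧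
  (∃ a : ℝ, chart φ (f 1) = X + a • (Z - X)) ∧
  (∃ a : ℝ, chart φ (f 2) = X + a • (Z - X)) ∧
  (∃ a : ℝ, chart φ (f 4) = Y + a • (Z - Y)) ∧
  (∃ a : ℝ, chart φ (f 5) = Y + a • (Z - Y)) ∧
  Dominant f 0 ∧
  (∀ i j : Fin 6, i ≠ j → ∀ a b c : ℝ, 0 < a → 0 < b → 0 < c → a + b + c = 1 →
    a • X + b • Y + c • Z ∉ Submodule.span ℝ ({(f i).rep, (f j).rep} : Set (Fin 3 → ℝ)))

/-- `v` is a homogeneous coordinate vector of the point `p`. -/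
def IsRep (p : RP2) (v : Fin 3 → ℝ) : Prop := ∃ k : ℝ, k ≠ 0 ∧ p.rep = k • v

theorem isRep_mk (v : Fin 3 → ℝ) (h : v ≠ 0) : IsRep (mk ℝ v h) v := by
  obtain ⟨a, ha⟩ := Projectivization.exists_smul_eq_mk_rep ℝ v h
  exact ⟨a, a.ne_zero, ha.symm⟩

theorem isRep_chart {φ : (Fin 3 → ℝ) →ₗ[ℝ] ℝ} {p : RP2} (h : φ p.rep ≠ 0) :
    IsRep p (chart φ p) :=
  ⟨φ p.rep, h, by simp [chart, smul_smul, h]⟩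

theorem apply_chart {φ : (Fin 3 → ℝ) →ₗ[ℝ] ℝ} {p : RP2} (h : φ p.rep ≠ 0) :
    φ (chart φ p) = 1 := by
  simp [chart, h]

namespace IsRep

variable {p p' : RP2} {v : Fin 3 → ℝ}

theorem ne_zero (h : IsRep p v) : v ≠ 0 := by
  rintro rfl
  obtain ⟨k, -, hk⟩ := h
  exact p.rep_nonzero (by simpa using hk)

theorem eq (h : IsRep p v) (h' : IsRep p' v) : p = p' := by
  obtain ⟨k, hk, e⟩ := h
  obtain ⟨k', hk', e'⟩ := h'
  rw [← p.mk_rep, ← p'.mk_rep, Projectivization.mk_eq_mk_iff']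
  exact ⟨k / k', by rw [e, e', smul_smul, div_mul_cancel₀ _ hk']⟩

theorem of_smul {c : ℝ} (h : IsRep p (c • v)) : IsRep p v := by
  have hc : c ≠ 0 := by
    rintro rfl
    exact h.ne_zero (zero_smul ℝ v)
  obtain ⟨k, hk, e⟩ := h
  exact ⟨k * c, mul_ne_zero hk hc, by rw [e, smul_smul]⟩

theorem chart_eq (h : IsRep p v) (φ : (Fin 3 → ℝ) →ₗ[ℝ] ℝ) : chart φ p = (φ v)⁻¹ • v := by
  obtain ⟨k, hk, e⟩ := h
  rw [chart, e, map_smul, smul_smul, smul_eq_mul, mul_inv_rev, inv_mul_cancel_right₀ hk]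

theorem apply_rep_ne_zero (h : IsRep p v) {φ : (Fin 3 → ℝ) →ₗ[ℝ] ℝ} (hv : φ v ≠ 0) :
    φ p.rep ≠ 0 := by
  obtain ⟨k, hk, e⟩ := h
  simp [e, hk, hv]

theorem quad_eq_zero_iff (h : IsRep p v) (q : QuadraticForm ℝ (Fin 3 → ℝ)) :
    q p.rep = 0 ↔ q v = 0 := by
  obtain ⟨k, hk, e⟩ := h
  simp [e, QuadraticMap.map_smul, hk]

theorem rep_mem_iff (h : IsRep p v) (W : Submodule ℝ (Fin 3 → ℝ)) : p.rep ∈ W ↔ v ∈ W := by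
  obtain ⟨k, hk, e⟩ := h
  rw [e, W.smul_mem_iff hk]

end IsRep

section Convex

variable {φ : (Fin 3 → ℝ) →ₗ[ℝ] ℝ} {f : Fin 6 → RP2} {w : Fin 6 → Fin 3 → ℝ}

/-- `ψ` supports the `i`-th edge of the hexagon with vertex vectors `w`. -/
def IsEdge (ψ : (Fin 3 → ℝ) →ₗ[ℝ] ℝ) (w : Fin 6 → Fin 3 → ℝ) (i : Fin 6) : Prop :=
  ψ (w i) = 0 ∧ ψ (w (i + 1)) = 0 ∧ ∀ j, j ≠ i → j ≠ i + 1 → ψ (w j) < 0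

theorem ConsecWith.exists_isEdge (h : ConsecWith φ f) (hw : ∀ i, IsRep (f i) (w i))
    (hpos : ∀ i, 0 < φ (w i)) (i : Fin 6) : ∃ ψ, IsEdge ψ w i := by
  obtain ⟨ψ, h1, h2⟩ := h.2 i
  have key : ∀ j, (ψ - ψ (chart φ (f i)) • φ) (w j) =
      φ (w j) * (ψ (chart φ (f j)) - ψ (chart φ (f i))) := by
    intro j
    have := (hpos j).ne'
    rw [(hw j).chart_eq φ, map_smul]
    simp only [LinearMap.sub_apply, LinearMap.smul_apply, smul_eq_mul]
    field_simp
  refine ⟨ψ - ψ (chart φ (f i)) • φ, ?_, ?_, fun j hj hj' => ?_⟩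
  · rw [key, sub_self, mul_zero]
  · rw [key, ← h1, sub_self, mul_zero]
  · rw [key]
    exact mul_neg_of_pos_of_neg (hpos j) (sub_neg.2 (h2 j hj hj'))

theorem exists_vertex_functional (he : ∀ i, ∃ ψ, IsEdge ψ w i) (i : Fin 6) :
    ∃ ψ : (Fin 3 → ℝ) →ₗ[ℝ] ℝ, ψ (w i) = 0 ∧ ∀ j, j ≠ i → ψ (w j) < 0 := by
  obtain ⟨ψ, h1, h2, h3⟩ := he i
  obtain ⟨χ, k1, k2, k3⟩ := he (i - 1)
  rw [sub_add_cancel] at k2 k3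
  refine ⟨ψ + χ, by simp [h1, k2], fun j hj => ?_⟩
  rw [LinearMap.add_apply]
  by_cases hj1 : j = i + 1
  · subst hj1
    rw [h2, zero_add]
    exact k3 _ (by clear * -; decide +revert) hj
  · have := h3 j hj hj1
    by_cases hj2 : j = i - 1
    · subst hj2
      rw [k1]
      linarith
    · linarith [k3 j hj2 hj]

theorem consecWith_of_isEdge (hw : ∀ i, IsRep (f i) (w i)) (hpos : ∀ i, 0 < φ (w i))
    (he : ∀ i, ∃ ψ, IsEdge ψ w i) : ConsecWith φ f := by
  have hval : ∀ (ψ : (Fin 3 → ℝ) →ₗ[ℝ] ℝ) j, ψ (chart φ (f j)) = (φ (w j))⁻¹ * ψ (w j) := by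
    intro ψ j
    rw [(hw j).chart_eq φ, map_smul, smul_eq_mul]
  have hneg : ∀ (ψ : (Fin 3 → ℝ) →ₗ[ℝ] ℝ) j, ψ (w j) < 0 → ψ (chart φ (f j)) < 0 := by
    intro ψ j h
    rw [hval]
    exact mul_neg_of_pos_of_neg (inv_pos.2 (hpos j)) h
  refine ⟨⟨?_, fun i => (hw i).apply_rep_ne_zero (hpos i).ne', fun i hi => ?_⟩, fun i => ?_⟩
  · rintro rfl
    simpa using hpos 0
  · obtain ⟨ψ, h1, h2⟩ := exists_vertex_functional he i
    have hsub : convexHull ℝ (chart φ '' (f '' {j | j ≠ i})) ⊆ {v | ψ v < 0} := by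
      refine convexHull_min ?_ (convex_halfSpace_lt ψ.isLinear 0)
      rintro _ ⟨_, ⟨j, hj, rfl⟩, rfl⟩
      exact hneg ψ j (h2 j hj)
    have : ψ (chart φ (f i)) < 0 := hsub hi
    rw [hval, h1, mul_zero] at this
    exact lt_irrefl _ this
  · obtain ⟨ψ, h1, h2, h3⟩ := he i
    refine ⟨ψ, by rw [hval, hval, h1, h2, mul_zero, mul_zero], fun j hj hj' => ?_⟩
    rw [hval ψ i, h1, mul_zero]
    exact hneg ψ j (h3 j hj hj')

theorem simpleCfg_of_isEdge (hw : ∀ i, IsRep (f i) (w i)) (he : ∀ i, ∃ ψ, IsEdge ψ w i) :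
    SimpleCfg f := by
  have hv := exists_vertex_functional he
  refine ⟨fun i j hij => ?_, fun i j k hij hik hjk hc => hc ?_⟩
  · by_contra hne
    obtain ⟨ψ, h1, h2⟩ := hv i
    obtain ⟨k, hk, e⟩ := hw i
    obtain ⟨k', hk', e'⟩ := hw j
    rw [hij, e'] at e
    have := congrArg ψ e
    rw [map_smul, map_smul, h1, smul_zero, smul_eq_mul, mul_eq_zero] at this
    exact this.elim hk' (h2 j (Ne.symm hne)).ne
  · have key : ∀ a b c : Fin 6, b ≠ a → c ≠ a → ∀ x y z : ℝ,
        x • w a + y • w b + z • w c = 0 → y * z < 0 ∨ y = 0 ∧ z = 0 := by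
      intro a b c hba hca x y z h
      obtain ⟨ψ, h1, h2⟩ := hv a
      have hm := h2 b hba
      have hn := h2 c hca
      have h0 : y * ψ (w b) + z * ψ (w c) = 0 := by simpa [h1] using congrArg ψ h
      rcases lt_trichotomy y 0 with hy | rfl | hy
      · left
        by_contra hz
        nlinarith [mul_pos_of_neg_of_neg hy hm]
      · right
        rw [zero_mul, zero_add, mul_eq_zero] at h0
        exact ⟨rfl, h0.resolve_right hn.ne⟩
      · left
        by_contra hz
        nlinarith [mul_neg_of_pos_of_neg hy hm]
    obtain ⟨r, hr, er⟩ := hw i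
    obtain ⟨s, hs, es⟩ := hw j
    obtain ⟨t, ht, et⟩ := hw k
    rw [er, es, et, Fintype.linearIndependent_iff]
    intro g hg
    simp only [Fin.sum_univ_three, Matrix.cons_val, smul_smul] at hg
    have h1 := key i j k hij.symm hik.symm _ _ _ hg
    have h2 := key j i k hij hjk.symm (g 1 * s) (g 0 * r) (g 2 * t) (by rw [← hg]; abel)
    have h3 := key k i j hik hjk (g 2 * t) (g 0 * r) (g 1 * s) (by rw [← hg]; abel)
    have : g 0 * r = 0 ∧ g 1 * s = 0 ∧ g 2 * t = 0 := by
      rcases h1 with h1 | h1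
      · rcases h2 with h2 | h2
        · rcases h3 with h3 | h3
          · nlinarith [mul_pos_of_neg_of_neg h1 h2, sq_nonneg (g 2 * t)]
          · simp [h3.2] at h1
        · simp [h2.2] at h1
      · rcases h2 with h2 | h2
        · simp [h1.2] at h2
        · exact ⟨h2.1, h1⟩
    simp only [mul_eq_zero, hr, hs, ht, or_false] at this
    intro l
    fin_cases l
    exacts [this.1, this.2.1, this.2.2]

end Convex

section Conic

variable {q : QuadraticForm ℝ (Fin 3 → ℝ)} {p : RP2} {v w : Fin 3 → ℝ}

theorem outsideConic_of_polar_eq_zero (hp : IsRep p v) {c : ℝ} (hv : 0 < c * q v)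
    (hw : 0 < c * q w) (hvw : QuadraticMap.polar q v w = 0) : OutsideConic q p := by
  have hval : ∀ x y : ℝ, c * q (x • v + y • w) = x ^ 2 * (c * q v) + y ^ 2 * (c * q w) := by
    intro x y
    rw [QuadraticMap.map_add q, q.polar_smul_left, q.polar_smul_right, hvw, q.map_smul, q.map_smul]
    simp only [smul_eq_mul]
    ring
  have hzero : ∀ x y : ℝ, q (x • v + y • w) = 0 → x = 0 ∧ y = 0 := by
    intro x y h
    have h0 := hval x y
    rw [h, mul_zero] at h0
    have hx := mul_nonneg (sq_nonneg x) hv.le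
    have hy := mul_nonneg (sq_nonneg y) hw.le
    have hx0 : x ^ 2 * (c * q v) = 0 := by linarith
    have hy0 : y ^ 2 * (c * q w) = 0 := by linarith
    exact ⟨by simpa [hv.ne'] using hx0, by simpa [hw.ne'] using hy0⟩
  have hli : LinearIndependent ℝ ![v, w] := LinearIndependent.pair_iff.2 fun x y h =>
    hzero x y (by rw [h, q.map_zero])
  refine ⟨_, ⟨Submodule.span ℝ {v, w}, ?_, rfl⟩, ?_, ?_⟩
  · have := finrank_span_eq_card hli
    rw [Matrix.range_cons_cons_empty] at this
    simpa using this
  · exact (hp.rep_mem_iff _).2 (Submodule.subset_span (by simp))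
  · rw [Set.eq_empty_iff_forall_notMem]
    rintro r ⟨hr, hr0⟩
    obtain ⟨x, y, e⟩ := Submodule.mem_span_pair.1 hr
    have hr0' : q r.rep = 0 := hr0
    rw [← e] at hr0'
    obtain ⟨rfl, rfl⟩ := hzero x y hr0'
    exact r.rep_nonzero (by rw [← e]; simp)

/-- A line containing a point with `q < 0` and one with `q ≥ 0` meets the conic. -/
theorem exists_quad_eq_zero {W : Submodule ℝ (Fin 3 → ℝ)} (hv : v ∈ W) (hw : w ∈ W)
    (hqv : q v < 0) (hqw : 0 ≤ q w) (hw0 : w ≠ 0) : ∃ u ∈ W, u ≠ 0 ∧ q u = 0 := by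
  have hval : ∀ t : ℝ, q ((1 - t) • v + t • w) =
      (1 - t) ^ 2 * q v + t ^ 2 * q w + (1 - t) * t * QuadraticMap.polar q v w := by
    intro t
    rw [QuadraticMap.map_add q, q.polar_smul_left, q.polar_smul_right, q.map_smul, q.map_smul]
    simp only [smul_eq_mul]
    ring
  have hcont : ContinuousOn (fun t : ℝ => q ((1 - t) • v + t • w)) (Set.Icc 0 1) := by
    simp only [hval]
    fun_prop
  obtain ⟨t, ht, h0⟩ := intermediate_value_Icc zero_le_one hcont
    (show (0 : ℝ) ∈ _ by simpa using ⟨hqv.le, hqw⟩)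
  refine ⟨_, W.add_mem (W.smul_mem (1 - t) hv) (W.smul_mem t hw), fun h => ?_, h0⟩
  have e := congrArg q (eq_neg_of_add_eq_zero_left h)
  rw [q.map_neg, q.map_smul, q.map_smul, smul_eq_mul, smul_eq_mul] at e
  have h1 : (1 - t) * (1 - t) = 0 := by
    nlinarith [mul_self_nonneg t, mul_self_nonneg (1 - t), mul_nonneg (mul_self_nonneg t) hqw]
  have h2 : t = 1 := by linarith [mul_self_eq_zero.1 h1]
  subst h2
  simp [hw0] at h

/-- Every line meets the region `q ≥ 0` if three points of the conic are joined pairwise by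
chords in the region `q < 0`. -/
theorem exists_quad_nonneg {W : Submodule ℝ (Fin 3 → ℝ)} (hW : Module.finrank ℝ W = 2)
    {v : Fin 3 → Fin 3 → ℝ} (hv : ∀ i, q (v i) = 0)
    (hneg : ∀ i j, i ≠ j → QuadraticMap.polar q (v i) (v j) < 0) :
    ∃ u ∈ W, u ≠ 0 ∧ 0 ≤ q u := by
  obtain ⟨l, hl0, hl⟩ := W.exists_le_ker_of_lt_top (lt_top_iff_ne_top.2 (by
    rintro rfl
    simp at hW))
  have hker : W = LinearMap.ker l := Submodule.eq_of_le_of_finrank_eq hl (by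
    have := Module.Dual.finrank_ker_add_one_of_ne_zero hl0
    simp at this
    omega)
  subst hker
  have pair : ∀ i j, i ≠ j → 0 < l (v i) * l (v j) → ∃ u ∈ LinearMap.ker l, u ≠ 0 ∧ 0 ≤ q u := by
    intro i j hij h
    have hq : 0 < q (l (v i) • v j - l (v j) • v i) := by
      rw [sub_eq_add_neg, ← neg_smul, QuadraticMap.map_add q, q.polar_smul_left,
        q.polar_smul_right, q.map_smul, q.map_smul, hv, hv]
      simp only [smul_eq_mul]
      have := mul_neg_of_pos_of_neg h (hneg j i hij.symm)
      linarith
    refine ⟨_, ?_, ?_, hq.le⟩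
    · simp [mul_comm]
    · intro h0
      rw [h0, q.map_zero] at hq
      exact lt_irrefl _ hq
  by_cases h : ∃ i, l (v i) = 0
  · obtain ⟨i, hi⟩ := h
    refine ⟨v i, hi, fun h0 => ?_, (hv i).ge⟩
    have := hneg i (i + 1) (by clear * -; decide +revert)
    rw [h0, q.polar_zero_left] at this
    exact lt_irrefl _ this
  · push Not at h
    rcases (h 0).lt_or_gt with h0 | h0 <;> rcases (h 1).lt_or_gt with h1 | h1 <;>
      rcases (h 2).lt_or_gt with h2 | h2
    · exact pair 0 1 (by decide) (mul_pos_of_neg_of_neg h0 h1)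
    · exact pair 0 1 (by decide) (mul_pos_of_neg_of_neg h0 h1)
    · exact pair 0 2 (by decide) (mul_pos_of_neg_of_neg h0 h2)
    · exact pair 1 2 (by decide) (mul_pos h1 h2)
    · exact pair 1 2 (by decide) (mul_pos_of_neg_of_neg h1 h2)
    · exact pair 0 2 (by decide) (mul_pos h0 h2)
    · exact pair 0 1 (by decide) (mul_pos h0 h1)
    · exact pair 0 1 (by decide) (mul_pos h0 h1)

theorem not_outsideConic (hp : IsRep p w) (hw : q w < 0) {v : Fin 3 → Fin 3 → ℝ}
    (hv : ∀ i, q (v i) = 0) (hneg : ∀ i j, i ≠ j → QuadraticMap.polar q (v i) (v j) < 0) :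
    ¬ OutsideConic q p := by
  rintro ⟨_, ⟨W, hW, rfl⟩, hpW, hempty⟩
  obtain ⟨u, huW, hu0, hu⟩ := exists_quad_nonneg hW hv hneg
  obtain ⟨z, hzW, hz0, hz⟩ := exists_quad_eq_zero ((hp.rep_mem_iff W).1 hpW) huW hw hu hu0
  have hrep := isRep_mk z hz0
  exact Set.eq_empty_iff_forall_notMem.1 hempty (mk ℝ z hz0)
    ⟨(hrep.rep_mem_iff W).2 hzW, (hrep.quad_eq_zero_iff q).2 hz⟩

end Conic

/-- Homogeneous coordinate vectors of six points on the sides of the triangle `X Y Z`. -/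
def triVec (X Y Z : Fin 3 → ℝ) (p : Fin 6 → ℝ) : Fin 6 → Fin 3 → ℝ :=
  ![p 0 • Y - X, p 1 • Z - X, p 2 • Z - X, p 3 • Y - X, p 4 • Y - Z, p 5 • Y - Z]

/-- The inequalities on the coordinates of `triVec` that characterize `TriSideCfg`. -/
structure TriParam (p : Fin 6 → ℝ) : Prop where
  one_lt_two : 1 < p 2
  two_lt_one : p 2 < p 1
  one_lt_four : 1 < p 4
  four_lt_five : p 4 < p 5
  one_lt_three : 1 < p 3
  three_lt : p 3 < p 2 * p 4
  lt_mul : p 1 * p 2 * p 4 * p 5 < p 0 * p 3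

namespace TriParam

variable {p : Fin 6 → ℝ}

theorem mul_lt (hp : TriParam p) : p 1 * p 5 < p 0 := by
  obtain ⟨h2, h21, h4, h45, h3, h324, h⟩ := hp
  have h15 : 0 < p 1 * p 5 := mul_pos (by linarith) (by linarith)
  by_contra! hle
  nlinarith [mul_le_mul_of_nonneg_right hle (show 0 ≤ p 3 by linarith),
    mul_lt_mul_of_pos_left h324 h15]

theorem three_lt_zero (hp : TriParam p) : p 3 < p 0 := by
  have := hp.mul_lt
  obtain ⟨h2, h21, h4, h45, h3, h324, h⟩ := hp
  nlinarith

end TriParam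

section Triangle

variable {X Y Z : Fin 3 → ℝ}

theorem linearIndependent_of_affineIndependent {φ : (Fin 3 → ℝ) →ₗ[ℝ] ℝ} (hX : φ X = 1)
    (hY : φ Y = 1) (hZ : φ Z = 1) (hnd : AffineIndependent ℝ ![X, Y, Z]) :
    LinearIndependent ℝ ![X, Y, Z] := by
  rw [Fintype.linearIndependent_iff]
  intro g hg
  have h0 : ∑ i, g i = 0 := by
    have := congrArg φ hg
    simpa [Fin.sum_univ_three, hX, hY, hZ] using this
  intro i
  exact (affineIndependent_iff.1 hnd) Finset.univ g h0 hg i (Finset.mem_univ i)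

theorem exists_functional (hli : LinearIndependent ℝ ![X, Y, Z]) (x y z : ℝ) :
    ∃ ψ : (Fin 3 → ℝ) →ₗ[ℝ] ℝ, ψ X = x ∧ ψ Y = y ∧ ψ Z = z := by
  let b := basisOfLinearIndependentOfCardEqFinrank hli (by simp)
  have hb : ∀ i, b i = ![X, Y, Z] i := by simp [b]
  have h := fun i => b.constr_basis ℝ ![x, y, z] i
  simp only [hb] at h
  exact ⟨b.constr ℝ ![x, y, z], h 0, h 1, h 2⟩

theorem exists_coordinates (hli : LinearIndependent ℝ ![X, Y, Z]) (v : Fin 3 → ℝ) :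
    ∃ x y z : ℝ, v = x • X + y • Y + z • Z := by
  let b := basisOfLinearIndependentOfCardEqFinrank hli (by simp)
  have hb : ∀ i, b i = ![X, Y, Z] i := by simp [b]
  have h := b.sum_repr v
  simp only [Fin.sum_univ_three, hb] at h
  exact ⟨_, _, _, h.symm⟩

/-- A functional with prescribed values on `X`, `Y`, `Z` that supports an edge of `triVec`. -/
theorem TriParam.exists_isEdge {p : Fin 6 → ℝ} (hp : TriParam p)
    (hli : LinearIndependent ℝ ![X, Y, Z]) (i : Fin 6) : ∃ ψ, IsEdge ψ (triVec X Y Z p) i := by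
  have h0 := hp.mul_lt
  have h30 := hp.three_lt_zero
  obtain ⟨h2, h21, h4, h45, h3, h324, h⟩ := hp
  have h25 : p 2 * p 4 < p 2 * p 5 := by gcongr
  have h14 : p 2 * p 4 < p 1 * p 4 := by gcongr
  have h15 : p 1 * p 4 < p 1 * p 5 := by gcongr; linarith
  have h25' : p 2 * p 5 < p 1 * p 5 := by gcongr; linarith
  have key : ∀ x y z : ℝ, (∀ ψ : (Fin 3 → ℝ) →ₗ[ℝ] ℝ, ψ X = x ∧ ψ Y = y ∧ ψ Z = z →
      IsEdge ψ (triVec X Y Z p) i) → ∃ ψ, IsEdge ψ (triVec X Y Z p) i := fun x y z H =>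
    let ⟨ψ, hψ⟩ := exists_functional hli x y z
    ⟨ψ, H ψ hψ⟩
  have fin_lemma : ∀ {P : Fin 6 → Prop}, P 0 → P 1 → P 2 → P 3 → P 4 → P 5 → ∀ j, P j := by
    intro P a b c d e f j
    fin_cases j <;> assumption
  fin_cases i
  · refine key (p 0 * p 1) (p 1) (p 0) fun ψ ⟨hx, hy, hz⟩ => ⟨?_, ?_, fun j => ?_⟩
    rotate_left 2
    · revert j
      apply fin_lemma <;> simp [triVec, hx, hy, hz] <;> nlinarith
    all_goals simp [triVec, hx, hy, hz] <;> ring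
  · refine key 0 (-1) 0 fun ψ ⟨hx, hy, hz⟩ => ⟨?_, ?_, fun j => ?_⟩
    rotate_left 2
    · revert j
      apply fin_lemma <;> simp [triVec, hx, hy, hz] <;> nlinarith
    all_goals simp [triVec, hx, hz]
  · refine key (-(p 2 * p 3)) (-p 2) (-p 3) fun ψ ⟨hx, hy, hz⟩ => ⟨?_, ?_, fun j => ?_⟩
    rotate_left 2
    · revert j
      apply fin_lemma <;> simp [triVec, hx, hy, hz] <;> nlinarith
    all_goals simp [triVec, hx, hy, hz] <;> ring
  · refine key (-p 3) (-1) (-p 4) fun ψ ⟨hx, hy, hz⟩ => ⟨?_, ?_, fun j => ?_⟩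
    rotate_left 2
    · revert j
      apply fin_lemma <;> simp [triVec, hx, hy, hz] <;> nlinarith
    all_goals simp [triVec, hx, hy, hz]
  · refine key 1 0 0 fun ψ ⟨hx, hy, hz⟩ => ⟨?_, ?_, fun j => ?_⟩
    rotate_left 2
    · revert j
      apply fin_lemma <;> simp [triVec, hx, hy, hz]
    all_goals simp [triVec, hy, hz]
  · refine key (p 0) 1 (p 5) fun ψ ⟨hx, hy, hz⟩ => ⟨?_, ?_, fun j => ?_⟩
    rotate_left 2
    · revert j
      apply fin_lemma <;> simp [triVec, hx, hy, hz] <;> nlinarith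
    all_goals simp [triVec, hx, hy, hz]

theorem quad_combination (q : QuadraticForm ℝ (Fin 3 → ℝ)) (x y z : ℝ) :
    q (x • X + y • Y + z • Z) = x ^ 2 * q X + y ^ 2 * q Y + z ^ 2 * q Z +
      x * y * QuadraticMap.polar q X Y + x * z * QuadraticMap.polar q X Z +
      y * z * QuadraticMap.polar q Y Z := by
  rw [QuadraticMap.map_add q, QuadraticMap.map_add q, q.polar_add_left]
  simp only [QuadraticMap.map_smul, QuadraticMap.polar_smul_left, QuadraticMap.polar_smul_right,
    smul_eq_mul]
  ring

theorem quad_smul_sub (q : QuadraticForm ℝ (Fin 3 → ℝ)) (u v : Fin 3 → ℝ) (a : ℝ) :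
    q (a • u - v) = q v + a ^ 2 * q u - a * QuadraticMap.polar q v u := by
  rw [sub_eq_add_neg, QuadraticMap.map_add q, q.polar_neg_right, q.polar_smul_left, q.map_neg,
    q.map_smul,
    QuadraticMap.polar_comm q u v, smul_eq_mul, smul_eq_mul]
  ring

/-- The coefficients of a quadratic form that vanishes on all but the first point. -/
theorem quad_coefficients {p : Fin 6 → ℝ} (hp : TriParam p) (q : QuadraticForm ℝ (Fin 3 → ℝ))
    (hq : ∀ j, j ≠ 0 → q (triVec X Y Z p j) = 0) :
    q X = q Y * (p 1 * p 2 * p 4 * p 5) ∧ q Z = q Y * (p 4 * p 5) ∧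
      p 3 * QuadraticMap.polar q X Y = q Y * (p 3 ^ 2 + p 1 * p 2 * p 4 * p 5) ∧
      QuadraticMap.polar q X Z = q Y * (p 4 * p 5 * (p 1 + p 2)) ∧
      QuadraticMap.polar q Y Z = q Y * (p 4 + p 5) := by
  have h1 : q (p 1 • Z - X) = 0 := hq 1 (by decide)
  have h2 : q (p 2 • Z - X) = 0 := hq 2 (by decide)
  have h3 : q (p 3 • Y - X) = 0 := hq 3 (by decide)
  have h4 : q (p 4 • Y - Z) = 0 := hq 4 (by decide)
  have h5 : q (p 5 • Y - Z) = 0 := hq 5 (by decide)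
  rw [quad_smul_sub] at h1 h2 h3 h4 h5
  rw [QuadraticMap.polar_comm] at h4 h5
  have e1 : QuadraticMap.polar q X Z = q Z * (p 1 + p 2) :=
    mul_left_cancel₀ (sub_ne_zero.2 hp.two_lt_one.ne') (by linear_combination h2 - h1)
  have e2 : QuadraticMap.polar q Y Z = q Y * (p 4 + p 5) :=
    mul_left_cancel₀ (sub_ne_zero.2 hp.four_lt_five.ne') (by linear_combination h4 - h5)
  have e3 : q Z = q Y * (p 4 * p 5) := by rw [e2] at h4; linear_combination h4
  have e4 : q X = q Z * (p 1 * p 2) := by rw [e1] at h1; linear_combination h1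
  rw [e3] at e1 e4
  refine ⟨by linear_combination e4, e3, by linear_combination e4 - h3,
    by linear_combination e1, e2⟩

theorem TriParam.quad_ne_zero {p : Fin 6 → ℝ} (hp : TriParam p)
    (hli : LinearIndependent ℝ ![X, Y, Z]) {q : QuadraticForm ℝ (Fin 3 → ℝ)} (hq0 : q ≠ 0)
    (hq : ∀ j, j ≠ 0 → q (triVec X Y Z p j) = 0) : q Y ≠ 0 := by
  intro hY
  obtain ⟨h1, h2, h3, h4, h5⟩ := quad_coefficients hp q hq
  rw [hY, zero_mul] at h1 h2 h3 h4 h5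
  have h3' := (mul_eq_zero.1 h3).resolve_left (by linarith [hp.one_lt_three])
  apply hq0
  ext v
  obtain ⟨x, y, z, rfl⟩ := exists_coordinates hli v
  rw [quad_combination, h1, h2, h3', h4, h5, hY]
  simp

/-- The first point has the sign of `q Y` with respect to the conic `q` through the others. -/
theorem TriParam.quad_mul_pos {p : Fin 6 → ℝ} (hp : TriParam p)
    (hli : LinearIndependent ℝ ![X, Y, Z]) {q : QuadraticForm ℝ (Fin 3 → ℝ)} (hq0 : q ≠ 0)
    (hq : ∀ j, j ≠ 0 → q (triVec X Y Z p j) = 0) : 0 < q Y * q (triVec X Y Z p 0) := by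
  have hY := hp.quad_ne_zero hli hq0 hq
  obtain ⟨h1, h2, h3, h4, h5⟩ := quad_coefficients hp q hq
  have h30 := hp.three_lt_zero
  obtain ⟨l2, l21, l4, l45, l3, l324, l⟩ := hp
  have e : p 3 * (q Y * q (triVec X Y Z p 0)) =
      q Y ^ 2 * ((p 0 - p 3) * (p 0 * p 3 - p 1 * p 2 * p 4 * p 5)) := by
    simp only [triVec, Matrix.cons_val, quad_smul_sub]
    rw [h1]
    linear_combination (-q Y * p 0) * h3
  have : 0 < p 3 * (q Y * q (triVec X Y Z p 0)) := by
    rw [e]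
    exact mul_pos (by positivity) (mul_pos (by linarith) (by linarith))
  exact pos_of_mul_pos_right this (by linarith)

theorem TriParam.dominant {p : Fin 6 → ℝ} (hp : TriParam p)
    (hli : LinearIndependent ℝ ![X, Y, Z]) {f : Fin 6 → RP2}
    (hf : ∀ i, IsRep (f i) (triVec X Y Z p i)) : Dominant f 0 := by
  intro q hq0 hq
  replace hq : ∀ j, j ≠ 0 → q (triVec X Y Z p j) = 0 := fun j hj =>
    ((hf j).quad_eq_zero_iff q).1 (hq j hj)
  have hY := hp.quad_ne_zero hli hq0 hq
  have hpos := hp.quad_mul_pos hli hq0 hq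
  obtain ⟨h1, h2, h3, h4, h5⟩ := quad_coefficients hp q hq
  have h30 := hp.three_lt_zero
  obtain ⟨l2, l21, l4, l45, l3, l324, l⟩ := hp
  have e2 := hq 2 (by decide)
  have e4 := hq 4 (by decide)
  have f02 : p 3 * QuadraticMap.polar q (triVec X Y Z p 0) (triVec X Y Z p 2) = q Y *
      (p 2 * p 4 * p 5 * (p 2 - p 1) * (p 0 - p 3) -
        p 0 * (p 3 - p 2 * p 4) * (p 3 - p 2 * p 5)) := by
    simp only [triVec, Matrix.cons_val, q.polar_sub_left, q.polar_sub_right, q.polar_smul_left,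
      q.polar_smul_right, q.polar_self, QuadraticMap.polar_comm q Y X, smul_eq_mul]
    rw [h1, h4, h5]
    linear_combination (-p 0) * h3
  have f04 : p 3 * QuadraticMap.polar q (triVec X Y Z p 0) (triVec X Y Z p 4) = q Y *
      (-(p 5 - p 4) * (p 0 * p 3 - p 1 * p 2 * p 4 * p 5) -
        p 4 * (p 3 - p 2 * p 5) * (p 3 - p 1 * p 5)) := by
    simp only [triVec, Matrix.cons_val, q.polar_sub_left, q.polar_sub_right, q.polar_smul_left,
      q.polar_smul_right, q.polar_self, smul_eq_mul]
    rw [h4, h5]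
    linear_combination (-p 4) * h3
  have f24 : p 3 * QuadraticMap.polar q (triVec X Y Z p 2) (triVec X Y Z p 4) = q Y *
      (-p 4 * (p 3 - p 1 * p 5) * (p 3 - p 2 * p 4)) := by
    simp only [triVec, Matrix.cons_val, q.polar_sub_left, q.polar_sub_right, q.polar_smul_left,
      q.polar_smul_right, q.polar_self, QuadraticMap.polar_comm q Z Y, smul_eq_mul]
    rw [h2, h4, h5]
    linear_combination (-p 4) * h3
  have hl3 : 0 < p 3 := by linarith
  have hYY : 0 < q Y ^ 2 := by positivity
  have l24 : p 3 - p 2 * p 4 < 0 := by linarith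
  have l25 : p 3 - p 2 * p 5 < 0 := by nlinarith
  have l15 : p 3 - p 1 * p 5 < 0 := by nlinarith
  have neg : ∀ b e : ℝ, p 3 * b = q Y * e → e < 0 → q Y * b < 0 := by
    intro b e hb he
    have : p 3 * (q Y * b) < 0 := by
      rw [show p 3 * (q Y * b) = q Y ^ 2 * e by linear_combination q Y * hb]
      exact mul_neg_of_pos_of_neg hYY he
    exact neg_of_mul_neg_right this hl3.le
  have g02 := neg _ _ f02 <| by
    have := mul_pos (mul_pos (mul_pos (mul_pos (show 0 < p 2 by linarith) (show 0 < p 4 by linarith))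
      (show 0 < p 5 by linarith)) (sub_pos.2 l21)) (sub_pos.2 h30)
    have := mul_pos (show 0 < p 0 by linarith) (mul_pos_of_neg_of_neg l24 l25)
    linarith
  have g04 := neg _ _ f04 <| by
    have := mul_pos (sub_pos.2 l45) (sub_pos.2 l)
    have := mul_pos (show 0 < p 4 by linarith) (mul_pos_of_neg_of_neg l25 l15)
    linarith
  have g24 := neg _ _ f24 <| by
    have := mul_pos (show 0 < p 4 by linarith) (mul_pos_of_neg_of_neg l15 l24)
    linarith
  refine outsideConic_of_polar_eq_zero (hf 0) (c := q Y) hpos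
    (w := QuadraticMap.polar q (triVec X Y Z p 0) (triVec X Y Z p 4) • triVec X Y Z p 2 -
      QuadraticMap.polar q (triVec X Y Z p 0) (triVec X Y Z p 2) • triVec X Y Z p 4) ?_ ?_
  · rw [sub_eq_add_neg, ← neg_smul, QuadraticMap.map_add q, q.polar_smul_left, q.polar_smul_right,
      q.map_smul, q.map_smul, e2, e4]
    simp only [smul_eq_mul]
    refine pos_of_mul_pos_right (a := q Y ^ 2) ?_ hYY.le
    have := mul_neg_of_pos_of_neg (mul_pos_of_neg_of_neg g02 g04) g24
    linarith
  · rw [q.polar_sub_right, q.polar_smul_right, q.polar_smul_right, smul_eq_mul, smul_eq_mul]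
    ring

end Triangle

section Characterization

variable {φ : (Fin 3 → ℝ) →ₗ[ℝ] ℝ} {X Y Z : Fin 3 → ℝ} {p : Fin 6 → ℝ} {f : Fin 6 → RP2}

theorem TriParam.one_lt (hp : TriParam p) (i : Fin 6) : 1 < p i := by
  have := hp.three_lt_zero
  obtain ⟨h2, h21, h4, h45, h3, h324, h⟩ := hp
  fin_cases i <;> dsimp <;> linarith

theorem map_triVec_pos (hX : φ X = 1) (hY : φ Y = 1) (hZ : φ Z = 1) (hp : ∀ i, 1 < p i)
    (i : Fin 6) : 0 < φ (triVec X Y Z p i) := by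
  fin_cases i <;> simp [triVec, hX, hY, hZ, hp]

theorem TriParam.typicalCfg (hp : TriParam p) (hli : LinearIndependent ℝ ![X, Y, Z])
    (hf : ∀ i, IsRep (f i) (triVec X Y Z p i)) : TypicalCfg f := by
  refine ⟨simpleCfg_of_isEdge hf (hp.exists_isEdge hli), ?_⟩
  rintro g hg ⟨q, hq0, hq⟩
  have hz : ∀ j, q (triVec X Y Z p j) = 0 := by
    intro j
    obtain ⟨i, rfl⟩ := Finite.injective_iff_surjective.1 hg j
    exact ((hf _).quad_eq_zero_iff q).1 (hq _ ⟨i, rfl⟩)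
  have := hp.quad_mul_pos hli hq0 fun j _ => hz j
  rw [hz, mul_zero] at this
  exact lt_irrefl _ this

theorem exists_nonneg_functional (hli : LinearIndependent ℝ ![X, Y, Z]) (hp : ∀ i, 0 < p i)
    (i j : Fin 6) (hij : i ≠ j) :
    ∃ ψ : (Fin 3 → ℝ) →ₗ[ℝ] ℝ, (0 ≤ ψ X ∧ 0 ≤ ψ Y ∧ 0 ≤ ψ Z ∧ 0 < ψ X + ψ Y + ψ Z) ∧
      ψ (triVec X Y Z p i) = 0 ∧ ψ (triVec X Y Z p j) = 0 := by
  wlog hlt : i < j generalizing i j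
  · obtain ⟨ψ, h, h1, h2⟩ := this j i hij.symm (lt_of_le_of_ne (not_lt.1 hlt) hij.symm)
    exact ⟨ψ, h, h2, h1⟩
  have YX_ZX : ∀ a b : ℝ, 0 < a → 0 < b → ∃ ψ : (Fin 3 → ℝ) →ₗ[ℝ] ℝ,
      (0 ≤ ψ X ∧ 0 ≤ ψ Y ∧ 0 ≤ ψ Z ∧ 0 < ψ X + ψ Y + ψ Z) ∧
        ψ (a • Y - X) = 0 ∧ ψ (b • Z - X) = 0 := by
    intro a b ha hb
    obtain ⟨ψ, h1, h2, h3⟩ := exists_functional hli (a * b) b a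
    refine ⟨ψ, ?_, ?_, ?_⟩
    · rw [h1, h2, h3]
      refine ⟨?_, ?_, ?_, ?_⟩ <;> positivity
    all_goals simp [h1, h2, h3, mul_comm]
  have YX_YZ : ∀ a b : ℝ, 0 < a → 0 < b → ∃ ψ : (Fin 3 → ℝ) →ₗ[ℝ] ℝ,
      (0 ≤ ψ X ∧ 0 ≤ ψ Y ∧ 0 ≤ ψ Z ∧ 0 < ψ X + ψ Y + ψ Z) ∧
        ψ (a • Y - X) = 0 ∧ ψ (b • Y - Z) = 0 := by
    intro a b ha hb
    obtain ⟨ψ, h1, h2, h3⟩ := exists_functional hli a 1 b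
    refine ⟨ψ, ?_, ?_, ?_⟩
    · rw [h1, h2, h3]
      refine ⟨?_, ?_, ?_, ?_⟩ <;> positivity
    all_goals simp [h1, h2, h3]
  have ZX_YZ : ∀ a b : ℝ, 0 < a → 0 < b → ∃ ψ : (Fin 3 → ℝ) →ₗ[ℝ] ℝ,
      (0 ≤ ψ X ∧ 0 ≤ ψ Y ∧ 0 ≤ ψ Z ∧ 0 < ψ X + ψ Y + ψ Z) ∧
        ψ (a • Z - X) = 0 ∧ ψ (b • Y - Z) = 0 := by
    intro a b ha hb
    obtain ⟨ψ, h1, h2, h3⟩ := exists_functional hli (a * b) 1 b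
    refine ⟨ψ, ?_, ?_, ?_⟩
    · rw [h1, h2, h3]
      refine ⟨?_, ?_, ?_, ?_⟩ <;> positivity
    all_goals simp [h1, h2, h3]
  have swap : ∀ u v : Fin 3 → ℝ, (∃ ψ : (Fin 3 → ℝ) →ₗ[ℝ] ℝ,
      (0 ≤ ψ X ∧ 0 ≤ ψ Y ∧ 0 ≤ ψ Z ∧ 0 < ψ X + ψ Y + ψ Z) ∧ ψ u = 0 ∧ ψ v = 0) →
      ∃ ψ : (Fin 3 → ℝ) →ₗ[ℝ] ℝ,
      (0 ≤ ψ X ∧ 0 ≤ ψ Y ∧ 0 ≤ ψ Z ∧ 0 < ψ X + ψ Y + ψ Z) ∧ ψ v = 0 ∧ ψ u = 0 :=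
    fun u v ⟨ψ, h, h1, h2⟩ => ⟨ψ, h, h2, h1⟩
  obtain ⟨x, hxX, hxY, hxZ⟩ := exists_functional hli 1 0 0
  obtain ⟨y, hyX, hyY, hyZ⟩ := exists_functional hli 0 1 0
  obtain ⟨z, hzX, hzY, hzZ⟩ := exists_functional hli 0 0 1
  fin_cases i <;> fin_cases j <;> first
    | exact absurd hlt (by decide)
    | exact YX_ZX _ _ (hp _) (hp _)
    | exact YX_YZ _ _ (hp _) (hp _)
    | exact ZX_YZ _ _ (hp _) (hp _)
    | exact swap _ _ (YX_ZX _ _ (hp _) (hp _))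
    | (refine ⟨x, ?_, ?_, ?_⟩ <;> simp [triVec, hxX, hxY, hxZ]; done)
    | (refine ⟨y, ?_, ?_, ?_⟩ <;> simp [triVec, hyX, hyY, hyZ]; done)
    | (refine ⟨z, ?_, ?_, ?_⟩ <;> simp [triVec, hzX, hzY, hzZ])

theorem TriParam.notMem_span (hp : TriParam p) (hli : LinearIndependent ℝ ![X, Y, Z])
    (hf : ∀ i, IsRep (f i) (triVec X Y Z p i)) (i j : Fin 6) (hij : i ≠ j) (a b c : ℝ)
    (ha : 0 < a) (hb : 0 < b) (hc : 0 < c) :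
    a • X + b • Y + c • Z ∉ Submodule.span ℝ ({(f i).rep, (f j).rep} : Set (Fin 3 → ℝ)) := by
  obtain ⟨ψ, ⟨h1, h2, h3, h⟩, hi, hj⟩ := exists_nonneg_functional hli
    (fun i => one_pos.trans (hp.one_lt i)) i j hij
  intro hmem
  have hle : Submodule.span ℝ ({(f i).rep, (f j).rep} : Set (Fin 3 → ℝ)) ≤ LinearMap.ker ψ := by
    rw [Submodule.span_le, Set.insert_subset_iff, Set.singleton_subset_iff]
    exact ⟨((hf i).rep_mem_iff _).2 hi, ((hf j).rep_mem_iff _).2 hj⟩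
  have h0 : a * ψ X + b * ψ Y + c * ψ Z = 0 := by simpa using hle hmem
  have ka := mul_nonneg ha.le h1
  have kb := mul_nonneg hb.le h2
  have kc := mul_nonneg hc.le h3
  have ea : ψ X = 0 := (mul_eq_zero.1 (by linarith : a * ψ X = 0)).resolve_left ha.ne'
  have eb : ψ Y = 0 := (mul_eq_zero.1 (by linarith : b * ψ Y = 0)).resolve_left hb.ne'
  have ec : ψ Z = 0 := (mul_eq_zero.1 (by linarith : c * ψ Z = 0)).resolve_left hc.ne'
  linarith

theorem inv_smul_smul_sub {c : ℝ} (hc : 1 < c) (u v : Fin 3 → ℝ) :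
    (c - 1)⁻¹ • (c • u - v) = u + (c - 1)⁻¹ • (u - v) := by
  have : c - 1 ≠ 0 := by linarith
  match_scalars <;> field_simp
  ring

theorem TriParam.triSideCfg (hX : φ X = 1) (hY : φ Y = 1) (hZ : φ Z = 1)
    (hli : LinearIndependent ℝ ![X, Y, Z]) (hp : TriParam p)
    (hf : ∀ i, IsRep (f i) (triVec X Y Z p i)) : TriSideCfg φ X Y Z f := by
  have h1 := hp.one_lt
  have hZX : ∀ i, IsRep (f i) (p i • Z - X) → ∃ a : ℝ, chart φ (f i) = X + a • (Z - X) := by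
    intro i hi
    refine ⟨1 + (p i - 1)⁻¹, ?_⟩
    rw [hi.chart_eq φ, map_sub, map_smul, hZ, hX, smul_eq_mul, mul_one, inv_smul_smul_sub (h1 i)]
    module
  have hYZ : ∀ i, IsRep (f i) (p i • Y - Z) → ∃ a : ℝ, chart φ (f i) = Y + a • (Z - Y) := by
    intro i hi
    refine ⟨-(p i - 1)⁻¹, ?_⟩
    rw [hi.chart_eq φ, map_sub, map_smul, hZ, hY, smul_eq_mul, mul_one, inv_smul_smul_sub (h1 i)]
    module
  have hYX : ∀ i, IsRep (f i) (p i • Y - X) →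
      chart φ (f i) = Y + (p i - 1)⁻¹ • (Y - X) := by
    intro i hi
    rw [hi.chart_eq φ, map_sub, map_smul, hX, hY, smul_eq_mul, mul_one, inv_smul_smul_sub (h1 i)]
  refine ⟨hp.typicalCfg hli hf, consecWith_of_isEdge hf (map_triVec_pos hX hY hZ h1)
    (hp.exists_isEdge hli), ⟨(p 0 - 1)⁻¹, (p 3 - 1)⁻¹, inv_pos.2 (sub_pos.2 (h1 0)), ?_,
    hYX 0 (hf 0), hYX 3 (hf 3)⟩, hZX 1 (hf 1), hZX 2 (hf 2), hYZ 4 (hf 4), hYZ 5 (hf 5),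
    hp.dominant hli hf, fun i j hij a b c ha hb hc _ =>
      hp.notMem_span hli hf i j hij a b c ha hb hc⟩
  exact inv_strictAnti₀ (sub_pos.2 (h1 3)) (sub_lt_sub_right hp.three_lt_zero 1)

/-- A configuration in convex position has coordinates satisfying all the linear constraints. -/
theorem two_lt_one_of_consecWith (hX : φ X = 1) (hY : φ Y = 1) (hZ : φ Z = 1)
    (hf : ∀ i, IsRep (f i) (triVec X Y Z p i)) (hp : ∀ i, 1 < p i) (h30 : p 3 < p 0)
    (hc : ConsecWith φ f) : p 2 < p 1 ∧ p 4 < p 5 ∧ p 3 < p 2 * p 4 := by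
  have he := hc.exists_isEdge hf (map_triVec_pos hX hY hZ hp)
  have pos : ∀ i, 0 < p i := fun i => one_pos.trans (hp i)
  refine ⟨?_, ?_, ?_⟩
  · obtain ⟨ψ, h0, h1, h⟩ := he 0
    have h2 := h 2 (by decide) (by decide)
    have h3 := h 3 (by decide) (by decide)
    simp [triVec] at h0 h1 h2 h3
    have hy : 0 < ψ Y := by nlinarith
    have hx : 0 < ψ X := by nlinarith [pos 0]
    have hz : 0 < ψ Z := by nlinarith [pos 1]
    nlinarith
  · obtain ⟨ψ, h5, h0, h⟩ := he 5
    have h3 := h 3 (by decide) (by decide)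
    have h4 := h 4 (by decide) (by decide)
    simp [triVec] at h0 h3 h4 h5
    have hy : 0 < ψ Y := by nlinarith
    nlinarith
  · obtain ⟨ψ, h2, h3, h⟩ := he 2
    have h0 := h 0 (by decide) (by decide)
    have h4 := h 4 (by decide) (by decide)
    simp [triVec] at h0 h2 h3 h4
    have hy : ψ Y < 0 := by nlinarith
    have e : p 2 * (p 4 * ψ Y - ψ Z) = (p 2 * p 4 - p 3) * ψ Y := by linear_combination h3 - h2
    nlinarith [mul_neg_of_pos_of_neg (pos 2) (by linarith : p 4 * ψ Y - ψ Z < 0)]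

theorem exists_quad (hli : LinearIndependent ℝ ![X, Y, Z]) (A B C D E F : ℝ) :
    ∃ q : QuadraticForm ℝ (Fin 3 → ℝ), q X = A ∧ q Y = B ∧ q Z = C ∧
      QuadraticMap.polar q X Y = D ∧ QuadraticMap.polar q X Z = E ∧
      QuadraticMap.polar q Y Z = F := by
  obtain ⟨x, hxX, hxY, hxZ⟩ := exists_functional hli 1 0 0
  obtain ⟨y, hyX, hyY, hyZ⟩ := exists_functional hli 0 1 0
  obtain ⟨z, hzX, hzY, hzZ⟩ := exists_functional hli 0 0 1
  refine ⟨A • QuadraticMap.linMulLin x x + B • QuadraticMap.linMulLin y y +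
    C • QuadraticMap.linMulLin z z + D • QuadraticMap.linMulLin x y +
    E • QuadraticMap.linMulLin x z + F • QuadraticMap.linMulLin y z, ?_⟩
  simp [QuadraticMap.polar, hxX, hxY, hxZ, hyX, hyY, hyZ, hzX, hzY, hzZ]
  refine ⟨by ring, by ring, by ring⟩

theorem lt_mul_of_dominant (hli : LinearIndependent ℝ ![X, Y, Z])
    (hf : ∀ i, IsRep (f i) (triVec X Y Z p i)) (hp : ∀ i, 1 < p i) (h30 : p 3 < p 0)
    (h21 : p 2 < p 1) (h45 : p 4 < p 5) (h324 : p 3 < p 2 * p 4) (ht : TypicalCfg f)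
    (hd : Dominant f 0) : p 1 * p 2 * p 4 * p 5 < p 0 * p 3 := by
  have pos : ∀ i, 0 < p i := fun i => one_pos.trans (hp i)
  obtain ⟨q, hX, hY, hZ, hXY, hXZ, hYZ⟩ := exists_quad hli (p 3 * (p 1 * p 2 * p 4 * p 5)) (p 3)
    (p 3 * (p 4 * p 5)) (p 3 ^ 2 + p 1 * p 2 * p 4 * p 5) (p 3 * (p 4 * p 5 * (p 1 + p 2)))
    (p 3 * (p 4 + p 5))
  have hq0 : q ≠ 0 := by
    rintro rfl
    exact (pos 3).ne hY
  have hZY := hYZ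
  rw [QuadraticMap.polar_comm] at hZY
  have q0 : q (triVec X Y Z p 0) = (p 0 - p 3) * (p 0 * p 3 - p 1 * p 2 * p 4 * p 5) := by
    simp only [triVec, Matrix.cons_val, quad_smul_sub, hX, hY, hXY]
    ring
  have hq : ∀ j, j ≠ 0 → q (triVec X Y Z p j) = 0 := by
    intro j hj
    fin_cases j
    · exact absurd rfl hj
    all_goals
      simp only [triVec, Matrix.cons_val, quad_smul_sub, hX, hY, hZ, hXY, hXZ, hZY, Fin.mk_one,
        Fin.reduceFinMk]
      ring
  by_contra! hle
  rcases hle.lt_or_eq with hlt | heq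
  · have l24 : p 3 - p 2 * p 4 < 0 := by linarith
    have l25 : p 3 - p 2 * p 5 < 0 := by nlinarith [pos 2]
    have l14 : p 3 - p 1 * p 4 < 0 := by nlinarith [pos 4]
    have l15 : p 3 - p 1 * p 5 < 0 := by nlinarith [pos 4, pos 1]
    have f12 : QuadraticMap.polar q (triVec X Y Z p 1) (triVec X Y Z p 2) < 0 := by
      have : QuadraticMap.polar q (triVec X Y Z p 1) (triVec X Y Z p 2) =
          -(p 3 * (p 4 * p 5) * (p 1 - p 2) ^ 2) := by
        simp only [triVec, Matrix.cons_val, q.polar_sub_left, q.polar_sub_right, q.polar_smul_left,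
          q.polar_smul_right, q.polar_self, QuadraticMap.polar_comm q Z X, smul_eq_mul, hX, hZ,
          hXZ]
        ring
      rw [this]
      exact neg_neg_of_pos (mul_pos (mul_pos (pos 3) (mul_pos (pos 4) (pos 5)))
        (pow_pos (sub_pos.2 h21) 2))
    have f14 : QuadraticMap.polar q (triVec X Y Z p 1) (triVec X Y Z p 4) < 0 := by
      have : QuadraticMap.polar q (triVec X Y Z p 1) (triVec X Y Z p 4) =
          -(p 4 * ((p 3 - p 2 * p 5) * (p 3 - p 1 * p 4))) := by
        simp only [triVec, Matrix.cons_val, q.polar_sub_left, q.polar_sub_right, q.polar_smul_left,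
          q.polar_smul_right, q.polar_self, QuadraticMap.polar_comm q Z Y, smul_eq_mul, hZ, hXY,
          hXZ, hYZ]
        ring
      rw [this]
      exact neg_neg_of_pos (mul_pos (pos 4) (mul_pos_of_neg_of_neg l25 l14))
    have f24 : QuadraticMap.polar q (triVec X Y Z p 2) (triVec X Y Z p 4) < 0 := by
      have : QuadraticMap.polar q (triVec X Y Z p 2) (triVec X Y Z p 4) =
          -(p 4 * ((p 3 - p 1 * p 5) * (p 3 - p 2 * p 4))) := by
        simp only [triVec, Matrix.cons_val, q.polar_sub_left, q.polar_sub_right, q.polar_smul_left,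
          q.polar_smul_right, q.polar_self, QuadraticMap.polar_comm q Z Y, smul_eq_mul, hZ, hXY,
          hXZ, hYZ]
        ring
      rw [this]
      exact neg_neg_of_pos (mul_pos (pos 4) (mul_pos_of_neg_of_neg l15 l24))
    have h0 : q (triVec X Y Z p 0) < 0 := by
      rw [q0]
      exact mul_neg_of_pos_of_neg (sub_pos.2 h30) (sub_neg.2 hlt)
    refine not_outsideConic (hf 0) h0
      (v := ![triVec X Y Z p 1, triVec X Y Z p 2, triVec X Y Z p 4]) (fun i => ?_)
      (fun i j hij => ?_) (hd q hq0 fun j hj => ((hf j).quad_eq_zero_iff q).2 (hq j hj))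
    · fin_cases i
      exacts [hq 1 (by decide), hq 2 (by decide), hq 4 (by decide)]
    · fin_cases i <;> fin_cases j <;> first
        | exact absurd rfl hij
        | assumption
        | (rw [QuadraticMap.polar_comm]; assumption)
  · refine ht.2 id Function.injective_id ⟨q, hq0, ?_⟩
    rintro _ ⟨j, rfl⟩
    refine ((hf j).quad_eq_zero_iff q).2 ?_
    by_cases hj : j = 0
    · rw [hj, q0, heq, sub_self, mul_zero]
    · exact hq j hj

end Characterization

section Path

variable {φ : (Fin 3 → ℝ) →ₗ[ℝ] ℝ} {X Y Z : Fin 3 → ℝ}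

/-- If no line `p₁ q` with `p₁` beyond `Y` on `XY` meets the open triangle, then `q` is not
strictly between `Y` and `Z`. -/
theorem nonpos_of_notMem_span {p p' : RP2} {s c : ℝ} (hs : 0 < s) (hc : c < 1)
    (hp : IsRep p (Y + s • (Y - X))) (hp' : IsRep p' (Y + c • (Z - Y)))
    (h : ∀ x y z : ℝ, 0 < x → 0 < y → 0 < z → x + y + z = 1 →
      x • X + y • Y + z • Z ∉ Submodule.span ℝ ({p.rep, p'.rep} : Set (Fin 3 → ℝ))) : c ≤ 0 := by
  by_contra! hc0
  have hcs : 0 < c + s := by linarith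
  obtain ⟨e, he0, he⟩ : ∃ e : ℝ, 0 < e ∧ e * (c + s) = (1 - c) / 2 :=
    ⟨(1 - c) / 2 / (c + s), div_pos (by linarith) hcs, div_mul_cancel₀ _ hcs.ne'⟩
  refine h (e * s) ((1 - c) / 2) (c * (1 + e)) (by positivity) (by linarith) (by positivity)
    (by linarith) ?_
  set W := Submodule.span ℝ ({p.rep, p'.rep} : Set (Fin 3 → ℝ)) with hW
  have m := (hp.rep_mem_iff W).1 (Submodule.subset_span (by simp))
  have m' := (hp'.rep_mem_iff W).1 (Submodule.subset_span (by simp))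
  have hsum := W.add_mem (W.smul_mem (1 + e) m') (W.smul_mem (-e) m)
  convert! hsum using 1
  rw [← sub_eq_zero]
  have : (1 - c) / 2 = (1 + e) * (1 - c) - e * (1 + s) := by linarith
  rw [this]
  module

/-- The projective coordinates of a configuration adapted to the triangle. -/
theorem TriSideCfg.exists_one_lt {f : Fin 6 → RP2} (h : TriSideCfg φ X Y Z f) :
    ∃ p : Fin 6 → ℝ, (∀ i, 1 < p i) ∧ p 3 < p 0 ∧ ∀ i, IsRep (f i) (triVec X Y Z p i) := by
  obtain ⟨-, hc, ⟨s, u, hs, hsu, h0, h3⟩, ⟨a, h1⟩, ⟨b, h2⟩, ⟨c, h4⟩, ⟨d, h5⟩, -, hspan⟩ := h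
  have hu : 0 < u := hs.trans hsu
  have hrep : ∀ i, IsRep (f i) (chart φ (f i)) := fun i => isRep_chart (hc.1.2.1 i)
  have he := hc.exists_isEdge hrep fun i => by
    rw [apply_chart (hc.1.2.1 i)]
    exact one_pos
  have hcd : c < 1 ∧ d < 1 := by
    obtain ⟨χ, -, k1, k⟩ := he 0
    have k1 : χ (chart φ (f 1)) = 0 := k1
    have k2 : χ (chart φ (f 2)) < 0 := k 2 (by decide) (by decide)
    have hab : a - b ≠ 0 := fun hab => by
      rw [h2, ← sub_eq_zero.1 hab, ← h1, k1] at k2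
      exact lt_irrefl _ k2
    obtain ⟨ψ, e1, e2, e⟩ := he 1
    have e1 : ψ (chart φ (f 1)) = 0 := e1
    have e2 : ψ (chart φ (f 2)) = 0 := e2
    have e0 : ψ (chart φ (f 0)) < 0 := e 0 (by decide) (by decide)
    have e4 : ψ (chart φ (f 4)) < 0 := e 4 (by decide) (by decide)
    have e5 : ψ (chart φ (f 5)) < 0 := e 5 (by decide) (by decide)
    simp only [h0, h1, h2, h4, h5, map_add, map_sub, map_smul, smul_eq_mul] at e0 e1 e2 e4 e5
    have hZX : ψ Z - ψ X = 0 :=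
      (mul_eq_zero.1 (show (a - b) * (ψ Z - ψ X) = 0 by linarith)).resolve_left hab
    rw [hZX, mul_zero, add_zero] at e1
    rw [e1, sub_zero] at e0 hZX
    rw [hZX] at e4 e5
    constructor <;> nlinarith
  have hab : 1 < a ∧ 1 < b := by
    obtain ⟨χ, -, k4, k⟩ := he 3
    have k4 : χ (chart φ (f 4)) = 0 := k4
    have k5 : χ (chart φ (f 5)) < 0 := k 5 (by decide) (by decide)
    have hcd : c - d ≠ 0 := fun hcd => by
      rw [h5, ← sub_eq_zero.1 hcd, ← h4, k4] at k5
      exact lt_irrefl _ k5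
    obtain ⟨ψ, e4, e5, e⟩ := he 4
    have e4 : ψ (chart φ (f 4)) = 0 := e4
    have e5 : ψ (chart φ (f 5)) = 0 := e5
    have e0 : ψ (chart φ (f 0)) < 0 := e 0 (by decide) (by decide)
    have e1 : ψ (chart φ (f 1)) < 0 := e 1 (by decide) (by decide)
    have e2 : ψ (chart φ (f 2)) < 0 := e 2 (by decide) (by decide)
    simp only [h0, h1, h2, h4, h5, map_add, map_sub, map_smul, smul_eq_mul] at e0 e1 e2 e4 e5
    have hZY : ψ Z - ψ Y = 0 :=
      (mul_eq_zero.1 (show (c - d) * (ψ Z - ψ Y) = 0 by linarith)).resolve_left hcd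
    rw [hZY, mul_zero, add_zero] at e4
    rw [e4, sub_zero] at hZY
    rw [e4] at e0
    rw [hZY] at e1 e2
    have hψX : 0 < ψ X := pos_of_mul_pos_right (show 0 < s * ψ X by linarith) hs.le
    constructor <;> nlinarith
  have hc0 : c < 0 := by
    refine lt_of_le_of_ne (nonpos_of_notMem_span hs hcd.1 (h0 ▸ hrep 0) (h4 ▸ hrep 4)
      (hspan 0 4 (by decide))) ?_
    rintro rfl
    obtain ⟨ψ, e3, e4, e⟩ := he 3
    have e0 := e 0 (by decide) (by decide)
    simp [h0, h3, h4] at e0 e3 e4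
    have hψX : ψ X = 0 := by
      simpa [e4, hu.ne'] using e3
    simp [e4, hψX] at e0
  have hd0 : d < 0 := by
    refine lt_of_le_of_ne (nonpos_of_notMem_span hs hcd.2 (h0 ▸ hrep 0) (h5 ▸ hrep 5)
      (hspan 0 5 (by decide))) ?_
    rintro rfl
    obtain ⟨ψ, e5, e0, e⟩ := he 5
    have e3 := e 3 (by decide) (by decide)
    simp [h0, h3, h5] at e0 e3 e5
    have hψX : ψ X = 0 := by
      simpa [e5, hs.ne'] using e0
    simp [e5, hψX] at e3
  refine ⟨![(1 + s) / s, a / (a - 1), b / (b - 1), (1 + u) / u, (1 - c) / (-c), (1 - d) / (-d)],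
    ?_, ?_, ?_⟩
  · have ha := sub_pos.2 hab.1
    have hb := sub_pos.2 hab.2
    have hc' := neg_pos.2 hc0
    have hd' := neg_pos.2 hd0
    intro i
    fin_cases i <;> refine (one_lt_div (by assumption)).2 (by linarith)
  · change (1 + u) / u < (1 + s) / s
    rw [div_lt_div_iff₀ hu hs]
    linarith
  · have key : ∀ (i) (k : ℝ) (v : Fin 3 → ℝ), chart φ (f i) = k • v → IsRep (f i) v :=
      fun i k v hv => IsRep.of_smul (c := k) (hv ▸ hrep i)
    have smul_eq : ∀ (k l : ℝ) (u v : Fin 3 → ℝ), k ≠ 0 → k • ((l / k) • u - v) = l • u - k • v :=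
      fun k l u v hk => by rw [smul_sub, smul_smul, mul_div_cancel₀ _ hk]
    have ha := (sub_pos.2 hab.1).ne'
    have hb := (sub_pos.2 hab.2).ne'
    have hc' := neg_ne_zero.2 hc0.ne
    have hd' := neg_ne_zero.2 hd0.ne
    intro i
    fin_cases i
    · exact key 0 s _ ((h0.trans (by module)).trans (smul_eq s (1 + s) Y X hs.ne').symm)
    · exact key 1 (a - 1) _ ((h1.trans (by module)).trans (smul_eq (a - 1) a Z X ha).symm)
    · exact key 2 (b - 1) _ ((h2.trans (by module)).trans (smul_eq (b - 1) b Z X hb).symm)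
    · exact key 3 u _ ((h3.trans (by module)).trans (smul_eq u (1 + u) Y X hu.ne').symm)
    · exact key 4 (-c) _ ((h4.trans (by module)).trans (smul_eq (-c) (1 - c) Y Z hc').symm)
    · exact key 5 (-d) _ ((h5.trans (by module)).trans (smul_eq (-d) (1 - d) Y Z hd').symm)

end Path

section Path

variable {φ : (Fin 3 → ℝ) →ₗ[ℝ] ℝ} {X Y Z : Fin 3 → ℝ}

/-- A configuration adapted to the triangle has admissible projective coordinates. -/
theorem TriSideCfg.exists_triParam (hX : φ X = 1) (hY : φ Y = 1) (hZ : φ Z = 1)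
    (hli : LinearIndependent ℝ ![X, Y, Z]) {f : Fin 6 → RP2} (h : TriSideCfg φ X Y Z f) :
    ∃ p : Fin 6 → ℝ, TriParam p ∧ ∀ i, IsRep (f i) (triVec X Y Z p i) := by
  obtain ⟨p, hp, h30, hf⟩ := h.exists_one_lt
  obtain ⟨ht, hc, -, -, -, -, -, hd, -⟩ := h
  obtain ⟨h21, h45, h324⟩ := two_lt_one_of_consecWith hX hY hZ hf hp h30 hc
  exact ⟨p, ⟨hp 2, h21, hp 4, h45, hp 3, h324,
    lt_mul_of_dominant hli hf hp h30 h21 h45 h324 ht hd⟩, hf⟩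

/-- Geometric interpolation of positive reals. -/
def geomPath (p p' : Fin 6 → ℝ) (t : ℝ) (i : Fin 6) : ℝ := p i ^ (1 - t) * p' i ^ t

/-- Each defining inequality of `TriParam` compares monomials, so it survives geometric
interpolation. -/
theorem TriParam.geomPath {p p' : Fin 6 → ℝ} (hp : TriParam p) (hp' : TriParam p') {t : ℝ}
    (h0 : 0 ≤ t) (h1 : t ≤ 1) : TriParam (geomPath p p' t) := by
  have key : ∀ {a b a' b' : ℝ}, 0 < a → 0 < a' → a < b → a' < b' →
      a ^ (1 - t) * a' ^ t < b ^ (1 - t) * b' ^ t := by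
    intro a b a' b' ha ha' hab hab'
    have hb := ha.trans hab
    have hb' := ha'.trans hab'
    rcases h0.eq_or_lt with rfl | h0
    · simpa using hab
    · exact mul_lt_mul_of_le_of_lt_of_pos_of_nonneg (Real.rpow_le_rpow ha.le hab.le (by linarith))
        (Real.rpow_lt_rpow ha'.le hab' h0) (Real.rpow_pos_of_pos ha _) (Real.rpow_nonneg hb'.le _)
  have mul : ∀ {a b a' b' : ℝ}, 0 < a → 0 < b → 0 < a' → 0 < b' → (a * b) ^ (1 - t) *
      (a' * b') ^ t = (a ^ (1 - t) * a' ^ t) * (b ^ (1 - t) * b' ^ t) := by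
    intro a b a' b' ha hb ha' hb'
    rw [Real.mul_rpow ha.le hb.le, Real.mul_rpow ha'.le hb'.le, mul_mul_mul_comm]
  have pos : ∀ i, 0 < p i := fun i => one_pos.trans (hp.one_lt i)
  have pos' : ∀ i, 0 < p' i := fun i => one_pos.trans (hp'.one_lt i)
  have one : ∀ i, 1 < _root_.geomPath p p' t i := fun i => by
    simpa using! key one_pos one_pos (hp.one_lt i) (hp'.one_lt i)
  refine ⟨one 2, key (pos 2) (pos' 2) hp.two_lt_one hp'.two_lt_one, one 4,
    key (pos 4) (pos' 4) hp.four_lt_five hp'.four_lt_five, one 3, ?_, ?_⟩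
  · refine (key (pos 3) (pos' 3) hp.three_lt hp'.three_lt).trans_eq ?_
    exact mul (pos 2) (pos 4) (pos' 2) (pos' 4)
  · have pos2 := fun i j => mul_pos (pos i) (pos j)
    have pos2' := fun i j => mul_pos (pos' i) (pos' j)
    have pos3 := fun i j k => mul_pos (pos2 i j) (pos k)
    have pos3' := fun i j k => mul_pos (pos2' i j) (pos' k)
    have h := key (mul_pos (pos3 1 2 4) (pos 5)) (mul_pos (pos3' 1 2 4) (pos' 5))
      hp.lt_mul hp'.lt_mul
    rwa [mul (pos3 1 2 4) (pos 5) (pos3' 1 2 4) (pos' 5), mul (pos2 1 2) (pos 4) (pos2' 1 2)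
      (pos' 4),
      mul (pos 1) (pos 2) (pos' 1) (pos' 2), mul (pos 0) (pos 3) (pos' 0) (pos' 3)] at h

theorem continuous_mk {T : Type*} [TopologicalSpace T] {v : T → Fin 3 → ℝ} (hv : Continuous v)
    (h : ∀ t, v t ≠ 0) : Continuous fun t => (mk ℝ (v t) (h t) : RP2) :=
  (continuous_quotient_mk' (s := projectivizationSetoid ℝ (Fin 3 → ℝ))).comp (hv.subtype_mk h)

theorem continuous_triVec {T : Type*} [TopologicalSpace T] {r : T → Fin 6 → ℝ} (hr : Continuous r)
    (i : Fin 6) : Continuous fun t => triVec X Y Z (r t) i := by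
  have : ∀ j, Continuous fun t => r t j := fun j => (continuous_apply j).comp hr
  fin_cases i <;> exact ((this _).smul continuous_const).sub continuous_const

end Path

/-- For a fixed line at infinity `{φ = 0}` and a fixed nondegenerate triangle `XYZ` in the
corresponding affine chart, the space of hexagonal typical 6-configurations adapted to the
triangle `XYZ` as above is path-connected. -/
theorem tri_side_space_connected (φ : (Fin 3 → ℝ) →ₗ[ℝ] ℝ) (hφ : φ ≠ 0)
    (X Y Z : Fin 3 → ℝ) (hX : φ X = 1) (hY : φ Y = 1) (hZ : φ Z = 1)
    (hnd : AffineIndependent ℝ ![X, Y, Z])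
    (f g : Fin 6 → RP2) (hf : TriSideCfg φ X Y Z f) (hg : TriSideCfg φ X Y Z g) :
    ∃ γ : Fin 6 → unitInterval → RP2, (∀ i, Continuous (γ i)) ∧
      (∀ i, γ i 0 = f i) ∧ (∀ i, γ i 1 = g i) ∧
      ∀ t : unitInterval, TriSideCfg φ X Y Z (fun i => γ i t) := by
  have hli := linearIndependent_of_affineIndependent hX hY hZ hnd
  obtain ⟨p, hp, hpf⟩ := hf.exists_triParam hX hY hZ hli
  obtain ⟨p', hp', hpg⟩ := hg.exists_triParam hX hY hZ hli
  have hr : ∀ t : unitInterval, TriParam (geomPath p p' t) := fun t => hp.geomPath hp' t.2.1 t.2.2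
  have hne : ∀ i (t : unitInterval), triVec X Y Z (geomPath p p' t) i ≠ 0 := fun i t h0 => by
    have := map_triVec_pos hX hY hZ (hr t).one_lt i
    simp [h0] at this
  have hcont : Continuous fun t : unitInterval => geomPath p p' t := by
    refine continuous_pi fun i => ?_
    have := (one_pos.trans (hp.one_lt i)).ne'
    have := (one_pos.trans (hp'.one_lt i)).ne'
    simp only [geomPath]
    fun_prop (disch := assumption)
  refine ⟨fun i t => mk ℝ _ (hne i t), fun i => continuous_mk (continuous_triVec hcont i) _,
    fun i => ?_, fun i => ?_, fun t => (hr t).triSideCfg hX hY hZ hli fun i => isRep_mk _ _⟩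
  · refine (isRep_mk _ _).eq ?_
    convert! hpf i
    ext j
    simp [geomPath]
  · refine (isRep_mk _ _).eq ?_
    convert! hpg i
    ext j
    simp [geomPath]

end
end

section
/- If six distinct points of ℙ²(ℝ) lie on a common conic and no three of them are collinear, then the six points are in convex position; i.e., every simple 6-configuration whose points are coconic is hexagonal. -/
open scoped LinearAlgebra.Projectivization
open Projectivization

noncomputable section

/-- A linear functional vanishing on three linearly independent vectors of `ℝ³` is zero. -/
lemma linearMap_eq_zero_of_linearIndependent {x y z : Fin 3 → ℝ}
    (h : LinearIndependent ℝ ![x, y, z]) (l : (Fin 3 → ℝ) →ₗ[ℝ] ℝ)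
    (hx : l x = 0) (hy : l y = 0) (hz : l z = 0) : l = 0 := by
  let b := basisOfLinearIndependentOfCardEqFinrank h (by simp)
  refine b.ext fun i => ?_
  fin_cases i <;> simp [b, hx, hy, hz]

/-- If `x, y, z, p, r` are points of a conic in general position, then `x` and `y` are not
conjugate with respect to the conic. -/
lemma polarBilin_ne_zero_of_linearIndependent {q : QuadraticForm ℝ (Fin 3 → ℝ)} (hq : q ≠ 0)
    {x y z p r : Fin 3 → ℝ} (hx : q x = 0) (hy : q y = 0) (hz : q z = 0) (hp : q p = 0)
    (hr : q r = 0) (hxyz : LinearIndependent ℝ ![x, y, z])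
    (hxyp : LinearIndependent ℝ ![x, y, p]) (hxyr : LinearIndependent ℝ ![x, y, r])
    (hzpr : LinearIndependent ℝ ![z, p, r]) : q.polarBilin x y ≠ 0 := by
  intro hxy
  have self : ∀ v, q.polarBilin v v = 2 * q v := fun v => by simp
  have symm : ∀ v w, q.polarBilin v w = q.polarBilin w v := fun v w => by
    simp [QuadraticMap.polar_comm]
  have conj : ∀ v, q v = 0 → LinearIndependent ℝ ![x, y, v] → q.polarBilin z v = 0 := by
    intro v hv hxyv
    let b := basisOfLinearIndependentOfCardEqFinrank hxyz (by simp)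
    obtain ⟨α, β, γ, rfl⟩ : ∃ α β γ : ℝ, v = α • x + β • y + γ • z := by
      refine ⟨b.repr v 0, b.repr v 1, b.repr v 2, ?_⟩
      conv_lhs => rw [← b.sum_repr v]
      simp [b, Fin.sum_univ_three]
    have hγ : γ ≠ 0 := by
      rintro rfl
      have := Fintype.linearIndependent_iff.1 hxyv ![α, β, -1] (by
        simp only [Fin.sum_univ_three, Matrix.cons_val]
        module) 2
      simp at this
    have hself := self (α • x + β • y + γ • z)
    have hxx := self x
    have hyy := self y
    have hzz := self z
    have hyx := symm y x
    have hzx := symm z x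
    have hzy := symm z y
    simp only [map_add, map_smul, LinearMap.add_apply, LinearMap.smul_apply, smul_eq_mul]
      at hself ⊢
    rw [hv, hxx, hyy, hzz, hx, hy, hz, hyx, hxy, ← hzx, ← hzy] at hself
    rw [hzz, hz]
    refine (mul_eq_zero.1 (?_ : (2 * γ) * _ = 0)).resolve_left (by simpa using hγ)
    linear_combination hself
  have hz0 : q.polarBilin z = 0 := linearMap_eq_zero_of_linearIndependent hzpr _
    (by rw [self, hz, mul_zero]) (conj p hp hxyp) (conj r hr hxyr)
  have hx0 : q.polarBilin x = 0 := linearMap_eq_zero_of_linearIndependent hxyz _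
    (by rw [self, hx, mul_zero]) hxy (by rw [symm, hz0, LinearMap.zero_apply])
  have hy0 : q.polarBilin y = 0 := linearMap_eq_zero_of_linearIndependent hxyz _
    (by rw [symm, hxy]) (by rw [self, hy, mul_zero]) (by rw [symm, hz0, LinearMap.zero_apply])
  refine hq (QuadraticMap.ext fun v => ?_)
  have hv : q.polarBilin.flip v = 0 := linearMap_eq_zero_of_linearIndependent hxyz _
    (by simp [hx0, -QuadraticMap.polarBilin_apply_apply])
    (by simp [hy0, -QuadraticMap.polarBilin_apply_apply])
    (by simp [hz0, -QuadraticMap.polarBilin_apply_apply])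
  have hvv := self v
  rw [← LinearMap.flip_apply, hv, LinearMap.zero_apply] at hvv
  simpa using hvv

/-- The Gram determinant of three isotropic vectors of a symmetric bilinear form on `ℝ³`. -/
lemma two_mul_mul_mul_eq_det_mul_det_sq (B : LinearMap.BilinForm ℝ (Fin 3 → ℝ))
    (symm : ∀ v w, B v w = B w v) {x y z : Fin 3 → ℝ}
    (hx : B x x = 0) (hy : B y y = 0) (hz : B z z = 0) :
    2 * (B x y * B x z * B y z) =
      (LinearMap.toMatrix₂' ℝ B).det * (Matrix.of ![x, y, z]).det ^ 2 := by
  set M := LinearMap.toMatrix₂' ℝ B with hM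
  have hB : ∀ v w, B v w = v ⬝ᵥ M.mulVec w := fun v w => by
    rw [← Matrix.toLinearMap₂'_apply', hM, Matrix.toLinearMap₂'_toMatrix']
  have hG : Matrix.of ![x, y, z] * M * (Matrix.of ![x, y, z]).transpose =
      !![B x x, B x y, B x z; B y x, B y y, B y z; B z x, B z y, B z z] := by
    ext i j
    rw [Matrix.mul_assoc]
    fin_cases i <;> fin_cases j <;>
      simp [hB, Matrix.mul_apply, dotProduct, Matrix.mulVec, Fin.sum_univ_three]
  have hdet := congrArg Matrix.det hG
  rw [Matrix.det_mul, Matrix.det_mul, Matrix.det_transpose, hx, hy, hz, symm y x, symm z x,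
    symm z y, Matrix.det_fin_three !![_, _, _; _, _, _; _, _, _]] at hdet
  simp only [Matrix.of_apply, Matrix.cons_val] at hdet
  linear_combination -hdet

/-- Points whose representatives are isotropic for a symmetric bilinear form `B`, and can be
rescaled so that `B` is positive on all pairs, are in convex position. -/
lemma convexPos_of_isotropic {n : ℕ} (f : Fin (n + 2) → RP2)
    (B : LinearMap.BilinForm ℝ (Fin 3 → ℝ)) (symm : ∀ v w, B v w = B w v)
    (hB : ∀ i, B (f i).rep (f i).rep = 0) (s : Fin (n + 2) → ℝ)
    (hpos : ∀ i j, i ≠ j → 0 < s i * s j * B (f i).rep (f j).rep) : ConvexPos f := by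
  have hφ : ∀ i, 0 < s i * B (s 0 • (f 0).rep + s 1 • (f 1).rep) (f i).rep := by
    intro i
    simp only [map_add, map_smul, LinearMap.add_apply, LinearMap.smul_apply, smul_eq_mul]
    have h01 := hpos 0 1 (by simp)
    rcases eq_or_ne i 0 with rfl | h0
    · rw [hB, symm (f 1).rep]
      linarith
    rcases eq_or_ne i 1 with rfl | h1
    · rw [hB]
      linarith
    have := hpos 0 i h0.symm
    have := hpos 1 i h1.symm
    linarith
  set φ : (Fin 3 → ℝ) →ₗ[ℝ] ℝ := B (s 0 • (f 0).rep + s 1 • (f 1).rep)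
  have hne : ∀ i, φ (f i).rep ≠ 0 := fun i => right_ne_zero_of_mul (hφ i).ne'
  refine ⟨φ, fun h => hne 0 (by simp [h]), hne, fun i hi => ?_⟩
  have hsub : convexHull ℝ (chart φ '' (f '' {j | j ≠ i})) ⊆
      {w | 0 < (s i • B (f i).rep) w} := by
    refine convexHull_min ?_ (convex_halfSpace_gt (LinearMap.isLinear _) 0)
    rintro _ ⟨_, ⟨j, hj, rfl⟩, rfl⟩
    have hsj : s j ≠ 0 := left_ne_zero_of_mul (hφ j).ne'
    have hquot := div_pos (hpos i j (Ne.symm hj)) (hφ j)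
    have heq : s i * s j * B (f i).rep (f j).rep / (s j * φ (f j).rep) =
        s i * ((φ (f j).rep)⁻¹ * B (f i).rep (f j).rep) := by
      have := hne j
      field_simp
    rw [heq] at hquot
    simpa [chart] using hquot
  have := hsub hi
  simp [chart, hB] at this

/-- Six distinct points of `ℙ²(ℝ)` lying on a common conic with no three collinear are in
convex position: every simple coconic 6-configuration is hexagonal. -/
theorem coconic_simple_is_hexagonal (f : Fin 6 → RP2)
    (hf : SimpleCfg f)
    (hconic : ∃ q : QuadraticForm ℝ (Fin 3 → ℝ), q ≠ 0 ∧ ∀ i, q ((f i).rep) = 0) :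
    ConvexPos f := by
  obtain ⟨q, hq, hzero, hdet⟩ : ∃ q : QuadraticForm ℝ (Fin 3 → ℝ), q ≠ 0 ∧
      (∀ i, q ((f i).rep) = 0) ∧ 0 ≤ (LinearMap.toMatrix₂' ℝ q.polarBilin).det := by
    obtain ⟨q, hq, hzero⟩ := hconic
    rcases le_total 0 (LinearMap.toMatrix₂' ℝ q.polarBilin).det with h | h
    · exact ⟨q, hq, hzero, h⟩
    · refine ⟨-q, neg_ne_zero.2 hq, fun i => by simp [hzero i], ?_⟩
      have hneg : LinearMap.toMatrix₂' ℝ (-q).polarBilin =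
          -LinearMap.toMatrix₂' ℝ q.polarBilin := by
        ext
        simp [LinearMap.toMatrix₂'_apply, QuadraticMap.polar_neg]
      rw [hneg, Matrix.det_neg]
      simpa [pow_succ] using h
  have hind : ∀ i j k, i ≠ j → i ≠ k → j ≠ k →
      LinearIndependent ℝ ![(f i).rep, (f j).rep, (f k).rep] :=
    fun i j k hij hik hjk => not_not.1 (hf.2 i j k hij hik hjk)
  have hself : ∀ i, q.polarBilin (f i).rep (f i).rep = 0 := fun i => by simp [hzero i]
  have symm : ∀ v w, q.polarBilin v w = q.polarBilin w v := fun v w => by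
    simp [QuadraticMap.polar_comm]
  have hne : ∀ i j, i ≠ j → q.polarBilin (f i).rep (f j).rep ≠ 0 := by
    intro i j hij
    obtain ⟨k, l, m, hik, hjk, hil, hjl, him, hjm, hkl, hkm, hlm⟩ :
        ∃ k l m : Fin 6, i ≠ k ∧ j ≠ k ∧ i ≠ l ∧ j ≠ l ∧ i ≠ m ∧ j ≠ m ∧
          k ≠ l ∧ k ≠ m ∧ l ≠ m := by
      revert i j
      decide
    exact polarBilin_ne_zero_of_linearIndependent hq (hzero i) (hzero j) (hzero k) (hzero l)
      (hzero m) (hind i j k hij hik hjk) (hind i j l hij hil hjl) (hind i j m hij him hjm)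
      (hind k l m hkl hkm hlm)
  refine convexPos_of_isotropic f q.polarBilin symm hself
    (fun i => if i = 0 then 1 else q.polarBilin (f 0).rep (f i).rep) fun i j hij => ?_
  rcases eq_or_ne i 0 with rfl | hi
  · rw [if_pos rfl, if_neg hij.symm, one_mul]
    exact mul_self_pos.2 (hne 0 j hij)
  rcases eq_or_ne j 0 with rfl | hj
  · rw [if_pos rfl, if_neg hi, mul_one, symm (f i).rep]
    exact mul_self_pos.2 (hne 0 i hi.symm)
  rw [if_neg hi, if_neg hj]
  have hgram := two_mul_mul_mul_eq_det_mul_det_sq q.polarBilin symm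
    (hself 0) (hself i) (hself j)
  have hnonneg := mul_nonneg hdet
    (sq_nonneg (Matrix.of ![(f 0).rep, (f i).rep, (f j).rep]).det)
  refine lt_of_le_of_ne (by linarith) (Ne.symm ?_)
  exact mul_ne_zero (mul_ne_zero (hne 0 i hi.symm) (hne 0 j hj.symm)) (hne i j hij)

end
end
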